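/- Fix a finite POMDP with nonnegative rewards (r x a ≥ 0 for all x, a). Fix k ≥ 1, a belief b₀ and actions a₀, …, a_{k−1}. Let φ₀ = b₀, φ_{j+1} = φ_j · a_j and X^R_j = {x : φ_j x > 0}, and assume (O x) z > 0 for every j ∈ {1, …, k}, every x ∈ X^R_j and every z ∈ Z. Define C_k = ∏_{j=1}^k (min {(O x) z : z ∈ Z, x ∈ X^R_j}) / (max {(O x) z : z ∈ Z, x ∈ X^R_j}). Then for every observation sequence z₁, …, z_k ∈ Z, the posterior beliefs b_j = (b_{j−1})^{a_{j−1}, z_j} are well-defined, and for every horizon L ≥ 1 and every action a_k: Q L b_k a_k ≥ C_k * Q^{OL} L φ_k a_k. (Lower-bound part of Theorem 4 for an open-loop topology on the first k steps.) -/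

import Mathlib

open Finset

set_option maxHeartbeats 1000000

attribute [local instance] Classical.propDecidable

/-- A finite POMDP: transition kernel, observation kernel and reward. -/
structure POMDP (X A Z : Type) where
  T : X → A → PMF X
  O : X → PMF Z
  r : X → A → ℝ

namespace POMDP

variable {X A Z : Type} [Fintype X] [Fintype A] [Fintype Z]
variable [Nonempty X] [Nonempty A] [Nonempty Z]

/-- Real-valued transition probability. -/
noncomputable def Tr (M : POMDP X A Z) (x : X) (a : A) (x' : X) : ℝ :=
  ((M.T x a) x').toReal

/-- Real-valued observation probability. -/
noncomputable def Ob (M : POMDP X A Z) (x : X) (z : Z) : ℝ :=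
  ((M.O x) z).toReal

/-- A belief: nonnegative and sums to one. -/
def IsBelief (b : X → ℝ) : Prop :=
  (∀ x, 0 ≤ b x) ∧ ∑ x, b x = 1

/-- The propagated belief `b·a`. -/
noncomputable def prop (M : POMDP X A Z) (b : X → ℝ) (a : A) : X → ℝ :=
  fun x' => ∑ x, b x * M.Tr x a x'

/-- Expected reward `R(b,a)`. -/
noncomputable def Rew (M : POMDP X A Z) (b : X → ℝ) (a : A) : ℝ :=
  ∑ x, b x * M.r x a

/-- Observation likelihood `P(z ∣ b, a)`. -/
noncomputable def obsLik (M : POMDP X A Z) (z : Z) (b : X → ℝ) (a : A) : ℝ :=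
  ∑ x', M.prop b a x' * M.Ob x' z

/-- Bayes posterior `b^{a,z}`. -/
noncomputable def post (M : POMDP X A Z) (b : X → ℝ) (a : A) (z : Z) : X → ℝ :=
  fun x' => M.Ob x' z * M.prop b a x' / M.obsLik z b a

/-- Closed-loop optimal value `V`. -/
noncomputable def V (M : POMDP X A Z) : ℕ → (X → ℝ) → ℝ
  | 0, _ => 0
  | n + 1, b =>
    Finset.univ.sup' Finset.univ_nonempty fun a =>
      M.Rew b a +
        ∑ z ∈ Finset.univ.filter (fun z => 0 < M.obsLik z b a),
          M.obsLik z b a * V M n (M.post b a z)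

/-- Closed-loop optimal Q-function `Q`. -/
noncomputable def Q (M : POMDP X A Z) : ℕ → (X → ℝ) → A → ℝ
  | 0, _, _ => 0
  | n + 1, b, a =>
    M.Rew b a +
      ∑ z ∈ Finset.univ.filter (fun z => 0 < M.obsLik z b a),
        M.obsLik z b a * V M n (M.post b a z)

/-- Open-loop optimal value `W`. -/
noncomputable def W (M : POMDP X A Z) : ℕ → (X → ℝ) → ℝ
  | 0, _ => 0
  | n + 1, b =>
    Finset.univ.sup' Finset.univ_nonempty fun a =>
      M.Rew b a + W M n (M.prop b a)

/-- Open-loop Q-function `Q^{OL}`. -/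
noncomputable def QOL (M : POMDP X A Z) : ℕ → (X → ℝ) → A → ℝ
  | 0, _, _ => 0
  | n + 1, b, a => M.Rew b a + W M n (M.prop b a)

/-- Fully observable (MDP) optimal value `U`. -/
noncomputable def U (M : POMDP X A Z) : ℕ → X → ℝ
  | 0, _ => 0
  | n + 1, x =>
    Finset.univ.sup' Finset.univ_nonempty fun a =>
      M.r x a + ∑ x', M.Tr x a x' * U M n x'

/-- QMDP Q-function `Q^{FO}`. -/
noncomputable def QFO (M : POMDP X A Z) : ℕ → (X → ℝ) → A → ℝ
  | 0, _, _ => 0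
  | n + 1, b, a => M.Rew b a + ∑ x', M.prop b a x' * U M n x'

/-- Adaptive open-loop optimal value `V^{AOL}_β` on histories of actions and observations. -/
noncomputable def VAOL (M : POMDP X A Z) (β : List (A ⊕ Z) → Bool) :
    ℕ → (X → ℝ) → List (A ⊕ Z) → ℝ
  | 0, _, _ => 0
  | n + 1, b, h =>
    Finset.univ.sup' Finset.univ_nonempty fun a =>
      M.Rew b a +
        (if β h = true then VAOL M β n (M.prop b a) (h ++ [Sum.inl a])
        else
          ∑ z ∈ Finset.univ.filter (fun z => 0 < M.obsLik z b a),
            M.obsLik z b a * VAOL M β n (M.post b a z) (h ++ [Sum.inl a, Sum.inr z]))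

/-- Adaptive open-loop Q-function `Q^{AOL}_β`. -/
noncomputable def QAOL (M : POMDP X A Z) (β : List (A ⊕ Z) → Bool) :
    ℕ → (X → ℝ) → A → List (A ⊕ Z) → ℝ
  | 0, _, _, _ => 0
  | n + 1, b, a, h =>
    M.Rew b a +
      (if β h = true then VAOL M β n (M.prop b a) (h ++ [Sum.inl a])
      else
        ∑ z ∈ Finset.univ.filter (fun z => 0 < M.obsLik z b a),
          M.obsLik z b a * VAOL M β n (M.post b a z) (h ++ [Sum.inl a, Sum.inr z]))

/-- Point-mass belief at `x'`. -/
noncomputable def delta (x' : X) : X → ℝ := fun x => if x = x' then 1 else 0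

/-- Adaptive fully-observable optimal value `V^{AFO}_β` on histories of
actions, observations and states. -/
noncomputable def VAFO (M : POMDP X A Z) (β : List (A ⊕ (Z ⊕ X)) → Bool) :
    ℕ → (X → ℝ) → List (A ⊕ (Z ⊕ X)) → ℝ
  | 0, _, _ => 0
  | n + 1, b, h =>
    Finset.univ.sup' Finset.univ_nonempty fun a =>
      M.Rew b a +
        (if β h = true then
          ∑ x', M.prop b a x' *
            VAFO M β n (delta x') (h ++ [Sum.inl a, Sum.inr (Sum.inr x')])
        else
          ∑ z ∈ Finset.univ.filter (fun z => 0 < M.obsLik z b a),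
            M.obsLik z b a *
              VAFO M β n (M.post b a z) (h ++ [Sum.inl a, Sum.inr (Sum.inl z)]))

/-- Adaptive fully-observable Q-function `Q^{AFO}_β`. -/
noncomputable def QAFO (M : POMDP X A Z) (β : List (A ⊕ (Z ⊕ X)) → Bool) :
    ℕ → (X → ℝ) → A → List (A ⊕ (Z ⊕ X)) → ℝ
  | 0, _, _, _ => 0
  | n + 1, b, a, h =>
    M.Rew b a +
      (if β h = true then
        ∑ x', M.prop b a x' *
          VAFO M β n (delta x') (h ++ [Sum.inl a, Sum.inr (Sum.inr x')])
      else
        ∑ z ∈ Finset.univ.filter (fun z => 0 < M.obsLik z b a),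
          M.obsLik z b a *
            VAFO M β n (M.post b a z) (h ++ [Sum.inl a, Sum.inr (Sum.inl z)]))

/-- Depth-indexed adaptive open-loop value. -/
noncomputable def VAOLd (M : POMDP X A Z) (β : ℕ → Bool) : ℕ → ℕ → (X → ℝ) → ℝ
  | _, 0, _ => 0
  | d, n + 1, b =>
    Finset.univ.sup' Finset.univ_nonempty fun a =>
      M.Rew b a +
        (if β d = true then VAOLd M β (d + 1) n (M.prop b a)
        else
          ∑ z ∈ Finset.univ.filter (fun z => 0 < M.obsLik z b a),
            M.obsLik z b a * VAOLd M β (d + 1) n (M.post b a z))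

/-- Depth-indexed adaptive fully-observable value. -/
noncomputable def VAFOd (M : POMDP X A Z) (β : ℕ → Bool) : ℕ → ℕ → (X → ℝ) → ℝ
  | _, 0, _ => 0
  | d, n + 1, b =>
    Finset.univ.sup' Finset.univ_nonempty fun a =>
      M.Rew b a +
        (if β d = true then
          ∑ x', M.prop b a x' * VAFOd M β (d + 1) n (delta x')
        else
          ∑ z ∈ Finset.univ.filter (fun z => 0 < M.obsLik z b a),
            M.obsLik z b a * VAFOd M β (d + 1) n (M.post b a z))

/-- Open-loop propagated beliefs `φ₀ = b`, `φ_{i+1} = φ_i · a i` along a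
finite action sequence. -/
noncomputable def propFin (M : POMDP X A Z) (b : X → ℝ) {n : ℕ} (a : Fin n → A)
    (j : Fin (n + 1)) : X → ℝ :=
  Fin.induction b (fun i ih => M.prop ih (a i)) j

end POMDP

namespace POMDP

section Aux

variable {X A Z : Type} [Fintype X] [Fintype A] [Fintype Z]
variable [Nonempty X] [Nonempty A] [Nonempty Z]

lemma Tr_nonneg (M : POMDP X A Z) (x : X) (a : A) (x' : X) : 0 ≤ M.Tr x a x' :=
  ENNReal.toReal_nonneg

lemma Ob_nonneg (M : POMDP X A Z) (x : X) (z : Z) : 0 ≤ M.Ob x z :=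
  ENNReal.toReal_nonneg

lemma pmf_sum_toReal {Y : Type} [Fintype Y] (p : PMF Y) : ∑ y, (p y).toReal = 1 := by
  rw [← ENNReal.toReal_sum (fun y _ => p.apply_ne_top y), ← tsum_fintype (L := .unconditional Y), p.tsum_coe]
  simp

lemma Tr_sum (M : POMDP X A Z) (x : X) (a : A) : ∑ x', M.Tr x a x' = 1 :=
  pmf_sum_toReal _

lemma Ob_sum (M : POMDP X A Z) (x : X) : ∑ z, M.Ob x z = 1 :=
  pmf_sum_toReal _

lemma prop_nonneg (M : POMDP X A Z) (b : X → ℝ) (hb : ∀ x, 0 ≤ b x) (a : A) (x : X) :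
    0 ≤ M.prop b a x :=
  Finset.sum_nonneg fun y _ => mul_nonneg (hb y) (M.Tr_nonneg _ _ _)

lemma prop_sum (M : POMDP X A Z) (b : X → ℝ) (a : A) :
    ∑ x, M.prop b a x = ∑ x, b x := by
  unfold prop
  rw [Finset.sum_comm]
  simp [← Finset.mul_sum, Tr_sum]

lemma prop_mono (M : POMDP X A Z) (b φ : X → ℝ) (c : ℝ) (h : ∀ x, c * φ x ≤ b x) (a : A)
    (x : X) : c * M.prop φ a x ≤ M.prop b a x := by
  unfold prop
  rw [Finset.mul_sum]
  refine Finset.sum_le_sum fun y _ => ?_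
  rw [← mul_assoc]
  exact mul_le_mul_of_nonneg_right (h y) (M.Tr_nonneg _ _ _)

lemma Rew_mono (M : POMDP X A Z) (hr : ∀ (x : X) (a : A), 0 ≤ M.r x a)
    (b φ : X → ℝ) (c : ℝ) (h : ∀ x, c * φ x ≤ b x) (a : A) :
    c * M.Rew φ a ≤ M.Rew b a := by
  unfold Rew
  rw [Finset.mul_sum]
  refine Finset.sum_le_sum fun y _ => ?_
  rw [← mul_assoc]
  exact mul_le_mul_of_nonneg_right (h y) (hr _ _)

lemma obsLik_nonneg (M : POMDP X A Z) (b : X → ℝ) (hb : ∀ x, 0 ≤ b x) (a : A) (z : Z) :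
    0 ≤ M.obsLik z b a :=
  Finset.sum_nonneg fun y _ => mul_nonneg (M.prop_nonneg b hb a y) (M.Ob_nonneg _ _)

lemma post_nonneg (M : POMDP X A Z) (b : X → ℝ) (hb : ∀ x, 0 ≤ b x) (a : A) (z : Z) (x : X) :
    0 ≤ M.post b a z x :=
  div_nonneg (mul_nonneg (M.Ob_nonneg _ _) (M.prop_nonneg b hb a x)) (M.obsLik_nonneg b hb a z)

lemma W_mono (M : POMDP X A Z) (hr : ∀ (x : X) (a : A), 0 ≤ M.r x a) (n : ℕ) :
    ∀ (b φ : X → ℝ) (c : ℝ), (∀ x, c * φ x ≤ b x) → c * M.W n φ ≤ M.W n b := by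
  induction n with
  | zero => intro b φ c _; simp [W]
  | succ n ih =>
    intro b φ c h
    simp only [W]
    obtain ⟨a, _, ha⟩ := Finset.exists_mem_eq_sup' (Finset.univ_nonempty (α := A))
      (fun a => M.Rew φ a + W M n (M.prop φ a))
    rw [ha]
    refine le_trans ?_ (Finset.le_sup' (fun a => M.Rew b a + W M n (M.prop b a))
      (Finset.mem_univ a))
    have h1 := M.Rew_mono hr b φ c h a
    have h2 := ih _ _ c (M.prop_mono b φ c h a)
    linarith

lemma W_convex (M : POMDP X A Z) {ι : Type} (s : Finset ι) (w : ι → ℝ) (hw : ∀ i ∈ s, 0 ≤ w i)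
    (n : ℕ) : ∀ (b : ι → X → ℝ),
      M.W n (fun x => ∑ i ∈ s, w i * b i x) ≤ ∑ i ∈ s, w i * M.W n (b i) := by
  induction n with
  | zero => intro b; simp [W]
  | succ n ih =>
    intro b
    rw [W]
    refine Finset.sup'_le _ _ fun a _ => ?_
    have h1 : M.Rew (fun x => ∑ i ∈ s, w i * b i x) a = ∑ i ∈ s, w i * M.Rew (b i) a := by
      unfold Rew
      simp only [Finset.sum_mul, Finset.mul_sum]
      rw [Finset.sum_comm]
      simp only [mul_assoc]
    have h2 : M.prop (fun x => ∑ i ∈ s, w i * b i x) a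
        = fun x => ∑ i ∈ s, w i * M.prop (b i) a x := by
      funext x
      unfold prop
      simp only [Finset.sum_mul, Finset.mul_sum]
      rw [Finset.sum_comm]
      simp only [mul_assoc]
    rw [h1, h2]
    have h3 := ih (fun i => M.prop (b i) a)
    refine le_trans (add_le_add_right h3 _) ?_
    rw [← Finset.sum_add_distrib]
    refine Finset.sum_le_sum fun i hi => ?_
    rw [← mul_add]
    refine mul_le_mul_of_nonneg_left ?_ (hw i hi)
    rw [W]
    exact Finset.le_sup' (fun a => M.Rew (b i) a + W M n (M.prop (b i) a)) (Finset.mem_univ a)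

lemma prop_decomp (M : POMDP X A Z) (b : X → ℝ) (hb : ∀ x, 0 ≤ b x) (a : A) :
    M.prop b a = fun x => ∑ z ∈ Finset.univ.filter (fun z => 0 < M.obsLik z b a),
      M.obsLik z b a * M.post b a z x := by
  funext x
  have h : ∀ z, (if 0 < M.obsLik z b a then M.obsLik z b a * M.post b a z x else 0)
      = M.Ob x z * M.prop b a x := by
    intro z
    split_ifs with hz
    · unfold post
      field_simp
    · have h0 : M.obsLik z b a = 0 := le_antisymm (not_lt.mp hz) (M.obsLik_nonneg b hb a z)
      unfold obsLik at h0
      rw [Finset.sum_eq_zero_iff_of_nonneg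
        (fun y _ => mul_nonneg (M.prop_nonneg b hb a y) (M.Ob_nonneg _ _))] at h0
      have := h0 x (Finset.mem_univ x)
      linarith
  rw [Finset.sum_filter, Finset.sum_congr rfl (fun z _ => h z), ← Finset.sum_mul, Ob_sum, one_mul]

lemma step_le (M : POMDP X A Z) (n : ℕ)
    (ih : ∀ b : X → ℝ, (∀ x, 0 ≤ b x) → M.W n b ≤ M.V n b)
    (b : X → ℝ) (hb : ∀ x, 0 ≤ b x) (a : A) :
    M.W n (M.prop b a) ≤ ∑ z ∈ Finset.univ.filter (fun z => 0 < M.obsLik z b a),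
          M.obsLik z b a * V M n (M.post b a z) := by
  rw [M.prop_decomp b hb a]
  refine le_trans (M.W_convex _ (fun z => M.obsLik z b a)
    (fun z _ => M.obsLik_nonneg b hb a z) n (fun z => M.post b a z)) ?_
  exact Finset.sum_le_sum fun z _ => mul_le_mul_of_nonneg_left
    (ih _ (M.post_nonneg b hb a z)) (M.obsLik_nonneg b hb a z)

lemma W_le_V (M : POMDP X A Z) (n : ℕ) :
    ∀ b : X → ℝ, (∀ x, 0 ≤ b x) → M.W n b ≤ M.V n b := by
  induction n with
  | zero => intro b _; simp [W, V]
  | succ n ih =>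
    intro b hb
    rw [W, V]
    refine Finset.sup'_mono_fun fun a _ => ?_
    have := M.step_le n ih b hb a
    linarith

lemma QOL_le_Q (M : POMDP X A Z) (hr : ∀ (x : X) (a : A), 0 ≤ M.r x a) (n : ℕ)
    (b φ : X → ℝ) (hb : ∀ x, 0 ≤ b x) (c : ℝ) (h : ∀ x, c * φ x ≤ b x) (a : A) :
    c * M.QOL n φ a ≤ M.Q n b a := by
  cases n with
  | zero => simp [QOL, Q]
  | succ n =>
    rw [QOL, Q]
    have h1 := M.Rew_mono hr b φ c h a
    have h2 := M.W_mono hr n _ _ c (M.prop_mono b φ c h a)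
    have h3 := M.step_le n (M.W_le_V n) b hb a
    linarith

/-- Invariant relating posterior and open-loop beliefs. -/
structure Inv (b φ : X → ℝ) (c : ℝ) : Prop where
  hc : 0 ≤ c
  hb : ∀ x, 0 ≤ b x
  hs : ∑ x, b x = 1
  hφ : ∀ x, 0 ≤ φ x
  le : ∀ x, c * φ x ≤ b x
  supp : ∀ x, φ x = 0 → b x = 0

lemma inv_step (M : POMDP X A Z) (b φ : X → ℝ) (c : ℝ) (h : Inv b φ c) (a : A) (z : Z)
    (hobs : ∀ x : X, 0 < M.prop φ a x → ∀ z : Z, 0 < M.Ob x z) :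
    0 < M.obsLik z b a ∧ Inv (M.post b a z) (M.prop φ a)
      (sInf (Set.image2 M.Ob {x | 0 < M.prop φ a x} (Set.univ : Set Z)) /
        sSup (Set.image2 M.Ob {x | 0 < M.prop φ a x} (Set.univ : Set Z)) * c) := by
  set S := Set.image2 M.Ob {x | 0 < M.prop φ a x} (Set.univ : Set Z) with hS
  have hfin : S.Finite := Set.Finite.image2 _ (Set.toFinite _) (Set.toFinite _)
  have hpb := M.prop_nonneg b h.hb a
  have hpφ := M.prop_nonneg φ h.hφ a
  have hsum : ∑ x, M.prop b a x = 1 := by rw [M.prop_sum, h.hs]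
  have hsupp : ∀ x, M.prop φ a x = 0 → M.prop b a x = 0 := by
    intro x hx
    unfold prop at hx ⊢
    rw [Finset.sum_eq_zero_iff_of_nonneg
      (fun y _ => mul_nonneg (h.hφ y) (M.Tr_nonneg _ _ _))] at hx
    refine Finset.sum_eq_zero fun y hy => ?_
    rcases mul_eq_zero.mp (hx y hy) with h0 | h0
    · rw [h.supp y h0, zero_mul]
    · rw [h0, mul_zero]
  have hpos : ∀ x, 0 < M.prop b a x → 0 < M.prop φ a x := fun x hx =>
    lt_of_le_of_ne (hpφ x) fun h0 => hx.ne' (hsupp x h0.symm)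
  obtain ⟨x₀, hx₀⟩ : ∃ x, 0 < M.prop b a x := by
    by_contra hne
    push Not at hne
    have : ∑ x, M.prop b a x ≤ 0 := Finset.sum_nonpos fun x _ => hne x
    linarith
  have hlik : 0 < M.obsLik z b a :=
    Finset.sum_pos' (fun y _ => mul_nonneg (hpb y) (M.Ob_nonneg _ _))
      ⟨x₀, Finset.mem_univ _, mul_pos hx₀ (hobs x₀ (hpos x₀ hx₀) z)⟩
  have hmem : ∀ x, 0 < M.prop φ a x → M.Ob x z ∈ S := fun x hx =>
    ⟨x, hx, z, Set.mem_univ _, rfl⟩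
  have hinf : ∀ x, 0 < M.prop φ a x → sInf S ≤ M.Ob x z := fun x hx =>
    csInf_le hfin.bddBelow (hmem x hx)
  have hsup : ∀ x, 0 < M.prop φ a x → M.Ob x z ≤ sSup S := fun x hx =>
    le_csSup hfin.bddAbove (hmem x hx)
  have hsupos : 0 < sSup S :=
    lt_of_lt_of_le (hobs x₀ (hpos x₀ hx₀) z) (hsup x₀ (hpos x₀ hx₀))
  have hinf0 : 0 ≤ sInf S := Real.sInf_nonneg (by
    rintro _ ⟨x, _, z, _, rfl⟩
    exact M.Ob_nonneg _ _)
  have hlikle : M.obsLik z b a ≤ sSup S := by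
    have : M.obsLik z b a ≤ ∑ x, M.prop b a x * sSup S := by
      refine Finset.sum_le_sum fun x _ => ?_
      rcases (hpb x).eq_or_lt with h0 | h0
      · rw [← h0, zero_mul, zero_mul]
      · exact mul_le_mul_of_nonneg_left (hsup x (hpos x h0)) (hpb x)
    rwa [← Finset.sum_mul, hsum, one_mul] at this
  refine ⟨hlik, ⟨mul_nonneg (div_nonneg hinf0 hsupos.le) h.hc, M.post_nonneg b h.hb a z, ?_,
    hpφ, ?_, ?_⟩⟩
  · unfold post
    rw [← Finset.sum_div, div_eq_one_iff_eq hlik.ne']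
    unfold obsLik
    exact Finset.sum_congr rfl fun x _ => mul_comm _ _
  · intro x
    rcases (hpφ x).eq_or_lt with h0 | h0
    · rw [← h0, mul_zero]
      exact M.post_nonneg b h.hb a z x
    · have h1 := M.prop_mono b φ c h.le a x
      have h2 : sInf S * (c * M.prop φ a x) ≤ M.Ob x z * M.prop b a x :=
        mul_le_mul (hinf x h0) h1 (mul_nonneg h.hc (hpφ x)) (M.Ob_nonneg _ _)
      have h3 : sInf S * (c * M.prop φ a x) / sSup S
          ≤ M.Ob x z * M.prop b a x / M.obsLik z b a :=
        div_le_div₀ (mul_nonneg (M.Ob_nonneg _ _) (hpb x)) h2 hlik hlikle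
      calc _ = sInf S * (c * M.prop φ a x) / sSup S := by ring
        _ ≤ _ := h3
  · intro x hx
    unfold post
    rw [hsupp x hx]
    simp

end Aux

end POMDP

/-- lower-bound part of Theorem 4, open-loop topology on the
first `k` steps: under positivity of the observation model on the reachable
sets, for every observation sequence the posterior beliefs are well-defined and
the closed-loop optimal Q-value at the final posterior belief is lower-bounded
by `C_k` times the open-loop Q-value at the open-loop propagated belief. -/
theorem skip_replanning_lower_bound {X A Z : Type}
    [Fintype X] [Fintype A] [Fintype Z]
    [Nonempty X] [Nonempty A] [Nonempty Z]
    (M : POMDP X A Z) (hr : ∀ (x : X) (a : A), 0 ≤ M.r x a)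
    (k : ℕ) (hk : 1 ≤ k)
    (b₀ : X → ℝ) (hb₀ : POMDP.IsBelief b₀)
    (a : Fin k → A)
    (φ : Fin (k + 1) → X → ℝ)
    (hφ0 : φ 0 = b₀)
    (hφ : ∀ j : Fin k, φ j.succ = M.prop (φ j.castSucc) (a j))
    (hobs : ∀ j : Fin k, ∀ x : X, 0 < φ j.succ x → ∀ z : Z, 0 < M.Ob x z) :
    ∀ (z : Fin k → Z) (bp : Fin (k + 1) → X → ℝ),
      bp 0 = b₀ →
      (∀ j : Fin k, bp j.succ = M.post (bp j.castSucc) (a j) (z j)) →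
      (∀ j : Fin k, 0 < M.obsLik (z j) (bp j.castSucc) (a j)) ∧
        ∀ L : ℕ, 1 ≤ L → ∀ aₖ : A,
          (∏ j : Fin k,
              sInf (Set.image2 M.Ob {x | 0 < φ j.succ x} (Set.univ : Set Z)) /
                sSup (Set.image2 M.Ob {x | 0 < φ j.succ x} (Set.univ : Set Z))) *
            M.QOL L (φ (Fin.last k)) aₖ ≤ M.Q L (bp (Fin.last k)) aₖ := by
  intro z bp hbp0 hbp
  set C : Fin k → ℝ := fun j =>
    sInf (Set.image2 M.Ob {x | 0 < φ j.succ x} (Set.univ : Set Z)) /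
      sSup (Set.image2 M.Ob {x | 0 < φ j.succ x} (Set.univ : Set Z)) with hC
  have step : ∀ (j : Fin k) (c : ℝ), POMDP.Inv (bp j.castSucc) (φ j.castSucc) c →
      0 < M.obsLik (z j) (bp j.castSucc) (a j) ∧
        POMDP.Inv (bp j.succ) (φ j.succ) (C j * c) := by
    intro j c hI
    have hob := hobs j
    simp only [hC]
    rw [hφ j] at hob ⊢
    rw [hbp j]
    exact M.inv_step _ _ c hI (a j) (z j) hob
  have key : ∀ j : Fin (k + 1), POMDP.Inv (bp j) (φ j)
      (∏ i ∈ Finset.univ.filter (fun i : Fin k => i.castSucc < j), C i) := by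
    intro j
    induction j using Fin.induction with
    | zero =>
      rw [hbp0, hφ0]
      simp only [Fin.not_lt_zero, Finset.filter_false, Finset.prod_empty]
      exact ⟨zero_le_one, hb₀.1, hb₀.2, hb₀.1, fun x => (one_mul _).le, fun x hx => hx⟩
    | succ j ih =>
      have hset : Finset.univ.filter (fun i : Fin k => i.castSucc < j.succ)
          = insert j (Finset.univ.filter (fun i : Fin k => i.castSucc < j.castSucc)) := by
        ext i
        simp only [Finset.mem_filter, Finset.mem_univ, true_and, Finset.mem_insert,
          Fin.lt_def, Fin.val_castSucc, Fin.val_succ, Fin.ext_iff]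
        omega
      rw [hset, Finset.prod_insert (by simp)]
      exact (step j _ ih).2
  refine ⟨fun j => (step j _ (key j.castSucc)).1, fun L _ aₖ => ?_⟩
  have hl := key (Fin.last k)
  have hset : Finset.univ.filter (fun i : Fin k => i.castSucc < Fin.last k) = Finset.univ := by
    ext i
    simp [Fin.castSucc_lt_last]
  rw [hset] at hl
  exact M.QOL_le_Q hr L _ _ hl.hb _ hl.le aₖ
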